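/- There exists a universal constant C ∈ (0,∞) such that the following holds. Fix n ∈ ℕ and let x_1,…,x_n be vectors in the closed unit ball of a real Hilbert space H. Then for every ε ∈ (0,1) there exists d ∈ ℕ with d ≤ C·(log n)³/ε⁴ and points y_1,…,y_n ∈ ℓ_2^d such that for all i,j ∈ {1,…,n}: ‖x_i − x_j‖_H − ε ≤ ‖y_i − y_j‖_{ℓ_2^d} ≤ ‖x_i − x_j‖_H + ε. -/

import Mathlib

open MeasureTheory
open ProbabilityTheory

/-- A quadratic lower bound for `log (1 - b)`, in exponential form. -/
lemma exp_neg_add_sq_le_one_sub {b : ℝ} (hb : |b| ≤ 1 / 4) :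
    Real.exp (-(b + b ^ 2)) ≤ 1 - b := by
  have hpos : 0 < 1 - b := by linarith [le_abs_self b]
  rw [← Real.le_log_iff_exp_le hpos]
  have h := Real.abs_log_sub_add_sum_range_le (x := b) (by linarith) 2
  norm_num [Finset.sum_range_succ] at h
  have hrem : |b| ^ 3 / (1 - |b|) ≤ b ^ 2 / 2 := by
    rw [div_le_iff₀ (by linarith), ← sq_abs b]
    nlinarith [sq_nonneg |b|]
  linarith [(abs_le.1 (h.trans hrem)).1]

lemma integrable_exp_mul_sq_gaussianReal {a : ℝ} (ha : a < 1 / 2) :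
    Integrable (fun x ↦ Real.exp (a * x ^ 2)) (gaussianReal 0 1) := by
  rw [gaussianReal_of_var_ne_zero _ one_ne_zero,
    integrable_withDensity_iff_integrable_smul' (measurable_gaussianPDF 0 1)
      (ae_of_all _ fun _ ↦ gaussianPDF_lt_top)]
  refine ((integrable_exp_neg_mul_sq (b := 1 / 2 - a) (by linarith)).const_mul
    (√(2 * Real.pi))⁻¹).congr (ae_of_all _ fun x ↦ ?_)
  simp only [toReal_gaussianPDF, gaussianPDFReal, smul_eq_mul, NNReal.coe_one, mul_one, sub_zero]
  rw [mul_assoc, ← Real.exp_add]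
  ring_nf

lemma integral_exp_mul_sq_gaussianReal {a : ℝ} (ha : a < 1 / 2) :
    ∫ x, Real.exp (a * x ^ 2) ∂gaussianReal 0 1 = (√(1 - 2 * a))⁻¹ := by
  have h (x : ℝ) : gaussianPDFReal 0 1 x • Real.exp (a * x ^ 2) =
      (√(2 * Real.pi))⁻¹ * Real.exp (-(1 / 2 - a) * x ^ 2) := by
    simp only [gaussianPDFReal, smul_eq_mul, NNReal.coe_one, mul_one, sub_zero]
    rw [mul_assoc, ← Real.exp_add]
    ring_nf
  rw [integral_gaussianReal_eq_integral_smul one_ne_zero]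
  simp_rw [h]
  rw [integral_const_mul, integral_gaussian, ← Real.sqrt_inv, ← Real.sqrt_inv,
    ← Real.sqrt_mul (by positivity)]
  have : (1 / 2 - a) ≠ 0 := by linarith
  have : (1 - 2 * a) ≠ 0 := by linarith
  congr 1
  field_simp

lemma integral_exp_mul_sq_sub_one_gaussianReal_le {a : ℝ} (ha : |a| ≤ 1 / 8) :
    ∫ x, Real.exp (a * (x ^ 2 - 1)) ∂gaussianReal 0 1 ≤ Real.exp (2 * a ^ 2) := by
  have hlt : a < 1 / 2 := by linarith [le_abs_self a]
  have hb := exp_neg_add_sq_le_one_sub (b := 2 * a) (by rw [abs_mul, abs_two]; linarith)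
  have h (x : ℝ) : Real.exp (a * (x ^ 2 - 1)) = Real.exp (-a) * Real.exp (a * x ^ 2) := by
    rw [← Real.exp_add]; ring_nf
  simp_rw [h]
  rw [integral_const_mul, integral_exp_mul_sq_gaussianReal hlt]
  rw [← div_eq_mul_inv, div_le_iff₀ (Real.sqrt_pos.2 (by linarith))]
  have hs : Real.exp (-a - 2 * a ^ 2) ≤ √(1 - 2 * a) := by
    apply Real.le_sqrt_of_sq_le
    rw [← Real.exp_nat_mul]
    convert hb using 2
    push_cast; ring
  calc Real.exp (-a) = Real.exp (2 * a ^ 2) * Real.exp (-a - 2 * a ^ 2) := by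
        rw [← Real.exp_add]; ring_nf
    _ ≤ _ := by gcongr

section StdGaussian
variable {E : Type*} [NormedAddCommGroup E] [InnerProductSpace ℝ E] [FiniteDimensional ℝ E]
  [MeasurableSpace E] [BorelSpace E]

lemma stdGaussian_map_inner (v : E) :
    (stdGaussian E).map (fun g ↦ inner ℝ v g) = (gaussianReal 0 1).map (fun x ↦ ‖v‖ * x) := by
  have h := IsGaussian.map_eq_gaussianReal (μ := stdGaussian E) (innerSL ℝ v)
  rw [integral_strongDual_stdGaussian, variance_dual_stdGaussian, innerSL_apply_norm] at h
  rw [gaussianReal_map_const_mul]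
  have hvar : (‖v‖ ^ 2).toNNReal = NNReal.mk (‖v‖ ^ 2) (sq_nonneg _) :=
    NNReal.eq (Real.coe_toNNReal _ (sq_nonneg _))
  rw [hvar] at h
  rw [mul_zero, mul_one]
  exact h

lemma integrable_exp_mul_inner_sq_sub_stdGaussian (v : E) {t : ℝ} (ht : t * ‖v‖ ^ 2 < 1 / 2) :
    Integrable (fun g ↦ Real.exp (t * ((inner ℝ v g) ^ 2 - ‖v‖ ^ 2))) (stdGaussian E) := by
  have hmap : Integrable (fun x ↦ Real.exp (t * (x ^ 2 - ‖v‖ ^ 2)))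
      ((stdGaussian E).map fun g ↦ inner ℝ v g) := by
    rw [stdGaussian_map_inner, integrable_map_measure (by fun_prop) (by fun_prop)]
    refine ((integrable_exp_mul_sq_gaussianReal ht).const_mul
      (Real.exp (-(t * ‖v‖ ^ 2)))).congr (ae_of_all _ fun x ↦ ?_)
    simp only [Function.comp_apply, ← Real.exp_add]
    ring_nf
  exact hmap.comp_measurable (by fun_prop)

lemma integral_exp_mul_inner_sq_sub_stdGaussian_le (v : E) {t : ℝ} (ht : |t * ‖v‖ ^ 2| ≤ 1 / 8) :
    ∫ g, Real.exp (t * ((inner ℝ v g) ^ 2 - ‖v‖ ^ 2)) ∂stdGaussian E ≤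
      Real.exp (2 * (t * ‖v‖ ^ 2) ^ 2) := by
  rw [← integral_map (φ := fun g ↦ inner ℝ v g) (f := fun x ↦ Real.exp (t * (x ^ 2 - ‖v‖ ^ 2)))
    (by fun_prop) (by fun_prop), stdGaussian_map_inner, integral_map (by fun_prop) (by fun_prop)]
  refine le_of_eq_of_le (integral_congr_ae (ae_of_all _ fun x ↦ ?_))
    (integral_exp_mul_sq_sub_one_gaussianReal_le ht)
  simp only
  ring_nf

/-- Chernoff-type moment bound for the squared norm of a Gaussian sketch of `v`. -/
lemma integral_exp_mul_sum_inner_sq_sub_le (v : E) {t : ℝ} (ht : |t * ‖v‖ ^ 2| ≤ 1 / 8) (d : ℕ) :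
    Integrable (fun g : Fin d → E ↦ Real.exp (t * (∑ r, (inner ℝ v (g r)) ^ 2 - d * ‖v‖ ^ 2)))
      (Measure.pi fun _ ↦ stdGaussian E) ∧
    ∫ g : Fin d → E, Real.exp (t * (∑ r, (inner ℝ v (g r)) ^ 2 - d * ‖v‖ ^ 2))
      ∂(Measure.pi fun _ ↦ stdGaussian E) ≤ Real.exp (d * (2 * (t * ‖v‖ ^ 2) ^ 2)) := by
  have hprod (g : Fin d → E) :
      Real.exp (t * (∑ r, (inner ℝ v (g r)) ^ 2 - d * ‖v‖ ^ 2)) =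
        ∏ r, Real.exp (t * ((inner ℝ v (g r)) ^ 2 - ‖v‖ ^ 2)) := by
    rw [← Real.exp_sum, ← Finset.mul_sum, Finset.sum_sub_distrib]
    simp
  simp_rw [hprod]
  refine ⟨Integrable.fintype_prod fun _ ↦ integrable_exp_mul_inner_sq_sub_stdGaussian v
    (by linarith [le_abs_self (t * ‖v‖ ^ 2)]), ?_⟩
  rw [integral_fintype_prod_eq_pow (ι := Fin d)
    (fun g : E ↦ Real.exp (t * ((inner ℝ v g) ^ 2 - ‖v‖ ^ 2))), Fintype.card_fin, Real.exp_nat_mul]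
  exact pow_le_pow_left₀ (integral_nonneg fun _ ↦ (Real.exp_pos _).le)
    (integral_exp_mul_inner_sq_sub_stdGaussian_le v ht) d

/-- A Gaussian sketch simultaneously preserves the squared norms of finitely many vectors of
norm at most `2`, up to an additive error `η`. -/
lemma exists_abs_sum_inner_sq_sub_lt {ι : Type*} [Fintype ι] (v : ι → E) (hv : ∀ i, ‖v i‖ ≤ 2)
    {η : ℝ} (hη : 0 < η) (hη1 : η ≤ 1) (d : ℕ)
    (hd : 2 * Fintype.card ι * Real.exp (-(d * η ^ 2 / 128)) < 1) :
    ∃ g : Fin d → E, ∀ i, |∑ r, (inner ℝ (v i) (g r)) ^ 2 - d * ‖v i‖ ^ 2| < d * η := by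
  let μ : Measure (Fin d → E) := Measure.pi fun _ ↦ stdGaussian E
  let Z (i : ι) (g : Fin d → E) : ℝ := ∑ r, (inner ℝ (v i) (g r)) ^ 2 - d * ‖v i‖ ^ 2
  let c := Real.exp (-(η / 64 * (d * η)))
  have hsq (i : ι) : ‖v i‖ ^ 2 ≤ 4 := by nlinarith [hv i, norm_nonneg (v i)]
  have hmoment (i : ι) {t : ℝ} (ht : |t| = η / 64) :
      Integrable (fun g ↦ c * Real.exp (t * Z i g)) μ ∧
        ∫ g, c * Real.exp (t * Z i g) ∂μ ≤ Real.exp (-(d * η ^ 2 / 128)) := by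
    have hle : |t * ‖v i‖ ^ 2| ≤ η / 16 := by
      rw [abs_mul, ht, abs_of_nonneg (sq_nonneg _)]
      nlinarith [hsq i]
    obtain ⟨hint, hbound⟩ := integral_exp_mul_sum_inner_sq_sub_le (v i) (t := t)
      (by linarith) d
    refine ⟨hint.const_mul c, ?_⟩
    rw [integral_const_mul]
    refine (mul_le_mul_of_nonneg_left hbound (Real.exp_pos _).le).trans ?_
    rw [← Real.exp_add, Real.exp_le_exp]
    have hsq_le : (t * ‖v i‖ ^ 2) ^ 2 ≤ (η / 16) ^ 2 := sq_le_sq' (abs_le.1 hle).1 (abs_le.1 hle).2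
    have := mul_le_mul_of_nonneg_left hsq_le (Nat.cast_nonneg (α := ℝ) d)
    linarith
  have hpos (i : ι) := hmoment i (t := η / 64) (abs_of_pos (by positivity))
  have hneg (i : ι) := hmoment i (t := -(η / 64)) (by rw [abs_neg, abs_of_pos (by positivity)])
  let F (g : Fin d → E) : ℝ :=
    ∑ i, (c * Real.exp (η / 64 * Z i g) + c * Real.exp (-(η / 64) * Z i g))
  have hFint : Integrable F μ :=
    integrable_finsetSum _ fun i _ ↦ (hpos i).1.add (hneg i).1
  have hF : ∫ g, F g ∂μ < 1 := by
    refine lt_of_eq_of_lt (integral_finsetSum _ fun i _ ↦ (hpos i).1.add (hneg i).1) ?_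
    refine lt_of_le_of_lt (Finset.sum_le_card_nsmul _ _
      (2 * Real.exp (-(d * η ^ 2 / 128))) fun i _ ↦ ?_) (lt_of_eq_of_lt ?_ hd)
    · refine (integral_add (hpos i).1 (hneg i).1).trans_le ?_
      linarith [(hpos i).2, (hneg i).2]
    · simp only [Finset.card_univ, nsmul_eq_mul]
      ring
  obtain ⟨g, hg⟩ := exists_le_integral hFint
  refine ⟨g, fun i ↦ ?_⟩
  have hterm : c * Real.exp (η / 64 * Z i g) + c * Real.exp (-(η / 64) * Z i g) < 1 :=
    lt_of_le_of_lt (Finset.single_le_sum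
      (f := fun i ↦ c * Real.exp (η / 64 * Z i g) + c * Real.exp (-(η / 64) * Z i g))
      (fun i _ ↦ by positivity) (Finset.mem_univ i)) (hg.trans_lt hF)
  have hlt {z : ℝ} (hz : c * Real.exp (η / 64 * z) < 1) : z < d * η := by
    rw [← Real.exp_add, Real.exp_lt_one_iff] at hz
    by_contra! hcon
    nlinarith
  refine abs_lt.2 ⟨neg_lt.1 (hlt ?_), hlt ?_⟩
  · rw [mul_neg, ← neg_mul]
    exact lt_of_le_of_lt (le_add_of_nonneg_left (by positivity)) hterm
  · exact lt_of_le_of_lt (le_add_of_nonneg_right (by positivity)) hterm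

/-- Additive Johnson–Lindenstrauss lemma in the unit ball, finite-dimensional source. -/
lemma exists_euclidean_dist_approx {n d : ℕ} (hd : 0 < d) (x : Fin n → E) (hx : ∀ i, ‖x i‖ ≤ 1)
    {ε : ℝ} (hε : 0 < ε) (hε1 : ε ≤ 1)
    (hdn : 2 * (n : ℝ) ^ 2 * Real.exp (-(d * ε ^ 4 / 128)) < 1) :
    ∃ y : Fin n → EuclideanSpace ℝ (Fin d), ∀ i j, |‖y i - y j‖ - ‖x i - x j‖| ≤ ε := by
  obtain ⟨g, hg⟩ := exists_abs_sum_inner_sq_sub_lt (fun p : Fin n × Fin n ↦ x p.1 - x p.2)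
    (fun p ↦ (norm_sub_le _ _).trans (by linarith [hx p.1, hx p.2])) (η := ε ^ 2)
    (by positivity) (pow_le_one₀ hε.le hε1) d (by
      convert hdn using 4
      · simp [sq]
      · ring_nf)
  have hd' : (0 : ℝ) < d := by exact_mod_cast hd
  refine ⟨fun i ↦ WithLp.toLp 2 fun r ↦ (√d)⁻¹ * inner ℝ (x i) (g r), fun i j ↦ ?_⟩
  set y : Fin n → EuclideanSpace ℝ (Fin d) :=
    fun i ↦ WithLp.toLp 2 fun r ↦ (√d)⁻¹ * inner ℝ (x i) (g r)
  have hy : ‖y i - y j‖ ^ 2 = (d : ℝ)⁻¹ * ∑ r, (inner ℝ (x i - x j) (g r)) ^ 2 := by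
    rw [EuclideanSpace.real_norm_sq_eq, Finset.mul_sum]
    refine Finset.sum_congr rfl fun r _ ↦ ?_
    simp only [y, PiLp.sub_apply, inner_sub_left, ← mul_sub, mul_pow, inv_pow,
      Real.sq_sqrt hd'.le]
  have hsq : |‖y i - y j‖ ^ 2 - ‖x i - x j‖ ^ 2| < ε ^ 2 := by
    have h := hg (i, j)
    rw [hy, show (d : ℝ)⁻¹ * ∑ r, (inner ℝ (x i - x j) (g r)) ^ 2 - ‖x i - x j‖ ^ 2 =
      (d : ℝ)⁻¹ * (∑ r, (inner ℝ (x i - x j) (g r)) ^ 2 - d * ‖x i - x j‖ ^ 2) by field_simp,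
      abs_mul, abs_of_pos (inv_pos.2 hd'), inv_mul_lt_iff₀ hd']
    exact h
  refine abs_le_of_sq_le_sq (le_trans ?_ hsq.le) hε.le
  rw [sq_sub_sq, abs_mul, abs_of_nonneg (by positivity), ← sq_abs, sq]
  gcongr
  exact abs_le.2 ⟨by linarith [norm_nonneg (y i - y j)], by linarith [norm_nonneg (x i - x j)]⟩

end StdGaussian

/-- **Corollary 2.3 (additive dimension reduction for the unit ball of a Hilbert space).**
There is a universal constant `C ∈ (0,∞)` such that for every `n ∈ ℕ`, every family
`x₁, …, xₙ` in the closed unit ball of a real Hilbert space `H` and every `ε ∈ (0,1)`,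
there exists `d ≤ C (log n)³ / ε⁴` and points `y₁, …, yₙ ∈ ℓ_2^d` with
`‖x_i - x_j‖_H - ε ≤ ‖y_i - y_j‖_{ℓ_2^d} ≤ ‖x_i - x_j‖_H + ε`. -/
theorem hilbert_ball_additive_dimension_reduction :
    ∃ C : ℝ, 0 < C ∧
      ∀ (H : Type) [NormedAddCommGroup H] [InnerProductSpace ℝ H] [CompleteSpace H]
        (n : ℕ) (x : Fin n → H), (∀ i, ‖x i‖ ≤ 1) →
        ∀ ε ∈ Set.Ioo (0 : ℝ) 1,
          ∃ (d : ℕ) (y : Fin n → EuclideanSpace ℝ (Fin d)),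
            (d : ℝ) ≤ C * Real.log n ^ 3 / ε ^ 4 ∧
            ∀ i j, ‖x i - x j‖ - ε ≤ ‖y i - y j‖ ∧ ‖y i - y j‖ ≤ ‖x i - x j‖ + ε := by
  refine ⟨2100, by norm_num, ?_⟩
  rintro H _ _ _ n x hx ε ⟨hε, hε1⟩
  rcases Nat.lt_or_ge n 2 with hn | hn
  · refine ⟨0, 0, ?_, fun i j ↦ ?_⟩
    · interval_cases n <;> simp
    · obtain rfl : i = j := by ext; omega
      simpa using hε.le
  · have hn' : (2 : ℝ) ≤ n := by exact_mod_cast hn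
    have hlog : 1 / 2 < Real.log n :=
      lt_of_lt_of_le (by linarith [Real.log_two_gt_d9]) (Real.log_le_log two_pos hn')
    have hε4 : 0 < ε ^ 4 := by positivity
    let d := ⌈512 * Real.log n / ε ^ 4⌉₊
    have hd : 0 < d := Nat.ceil_pos.2 (by positivity)
    have hdn : 2 * (n : ℝ) ^ 2 * Real.exp (-(d * ε ^ 4 / 128)) < 1 := by
      have hle : 4 * Real.log n ≤ d * ε ^ 4 / 128 := by
        have := (div_le_iff₀ hε4).1 (Nat.le_ceil (512 * Real.log n / ε ^ 4))
        linarith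
      have hexp : Real.exp (-(d * ε ^ 4 / 128)) ≤ ((n : ℝ) ^ 4)⁻¹ := by
        refine (Real.exp_le_exp.2 (neg_le_neg hle)).trans_eq ?_
        rw [Real.exp_neg, ← Real.exp_log (show (0 : ℝ) < n by linarith), ← Real.exp_nat_mul,
          Real.log_exp]
        norm_num
      refine (mul_le_mul_of_nonneg_left hexp (by positivity)).trans_lt ?_
      rw [← div_eq_mul_inv, div_lt_one (by positivity)]
      have hn2 : 4 ≤ (n : ℝ) ^ 2 := by nlinarith
      nlinarith
    let K : Submodule ℝ H := Submodule.span ℝ (Set.range x)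
    have : FiniteDimensional ℝ K := FiniteDimensional.span_of_finite ℝ (Set.finite_range x)
    let : MeasurableSpace K := borel K
    have : BorelSpace K := ⟨rfl⟩
    obtain ⟨y, hy⟩ := exists_euclidean_dist_approx hd
      (fun i ↦ (⟨x i, Submodule.subset_span ⟨i, rfl⟩⟩ : K)) hx hε hε1.le hdn
    refine ⟨d, y, ?_, fun i j ↦ ?_⟩
    · refine (Nat.ceil_lt_add_one (by positivity)).le.trans ?_
      rw [div_add_one hε4.ne']
      gcongr
      have hε41 : ε ^ 4 ≤ 1 := pow_le_one₀ hε.le hε1.le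
      have hsq : 1 / 4 ≤ Real.log n ^ 2 := by nlinarith
      nlinarith
    · have h : |‖y i - y j‖ - ‖x i - x j‖| ≤ ε := hy i j
      constructor <;> linarith [abs_le.1 h]
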